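/- Let F = ∗_{α∈I} G_α be the free product of nontrivial groups G_α and let H be a finitely generated factor-free subgroup of F with H ≠ {1}. Then there exists a finite connected irreducible A-graph Ψ_o with a primary base vertex o (of degree 1 if Ψ_o has a vertex of degree 1) such that a reduced word W over the alphabet A belongs to H if and only if there is a reduced path p in Ψ_o with p₋ = p₊ = o, φ(p) = W in F, and |p| = 2|W|. -/

import Mathlib

open Monoid

section Defs

variable {F : Type} [Group F]

def conjS (t : F) (K : Subgroup F) : Subgroup F := K.map (MulAut.conj t).toMonoidHom

noncomputable def rk (H : Subgroup F) : ℕ :=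
  sInf {n : ℕ | ∃ S : Finset F, S.card = n ∧ Subgroup.closure (S : Set F) = H}

noncomputable def rrk (H : Subgroup F) : ℕ := rk H - 1

def dcSetoid (H K : Subgroup F) : Setoid F where
  r s t := ∃ h ∈ H, ∃ k ∈ K, h * s * k = t
  iseqv := by
    refine ⟨fun s => ⟨1, H.one_mem, 1, K.one_mem, by group⟩, ?_, ?_⟩
    · rintro s t ⟨h, hh, k, hk, rfl⟩
      exact ⟨h⁻¹, H.inv_mem hh, k⁻¹, K.inv_mem hk, by group⟩
    · rintro s t u ⟨h, hh, k, hk, rfl⟩ ⟨h', hh', k', hk', rfl⟩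
      exact ⟨h' * h, H.mul_mem hh' hh, k * k', K.mul_mem hk hk', by group⟩

noncomputable def rrkInter (H K : Subgroup F) : ℕ :=
  finsum fun q : Quotient (dcSetoid H K) => rrk (H ⊓ conjS q.out K)

def Noncyclic (H : Subgroup F) : Prop := ∀ g : F, H ≠ Subgroup.closure {g}

end Defs

section Graphs

/-- A labeled `A`-graph over the alphabet `A = ⊔_{i} G i`: a bipartite graph with
primary and secondary vertices, oriented edges with a fixed-point-free involution
`bar`, a type function on (secondary) vertices and an edge labeling. -/
structure AGraph (ι : Type) (G : ι → Type) [∀ i, Group (G i)] : Type 1 where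
  /-- vertices -/
  V : Type
  /-- oriented edges -/
  E : Type
  /-- `prim v` holds iff `v` is a primary vertex; otherwise `v` is secondary -/
  prim : V → Prop
  /-- the edge with the opposite orientation -/
  bar : E → E
  bar_bar : ∀ e, bar (bar e) = e
  bar_ne : ∀ e, bar e ≠ e
  /-- initial vertex -/
  ini : E → V
  /-- terminal vertex -/
  ter : E → V
  ini_bar : ∀ e, ini (bar e) = ter e
  /-- every edge connects a primary and a secondary vertex -/
  bipartite : ∀ e, prim (ini e) ↔ ¬ prim (ter e)
  /-- the type of a (secondary) vertex -/
  typ : V → ι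
  /-- the label of an edge, an element of `A = ⊔_i G i` -/
  lab : E → Σ i, G i
  lab_bar : ∀ e, lab (bar e) = ⟨(lab e).1, (lab e).2⁻¹⟩
  /-- the label of an edge ending in a secondary vertex of type `i` lies in `G i` -/
  lab_typ : ∀ e, ¬ prim (ter e) → (lab e).1 = typ (ter e)

namespace AGraph

variable {ι : Type} {G : ι → Type} [∀ i, Group (G i)] (Ψ : AGraph ι G)

/-- The degree of a vertex: the number of oriented edges ending at it. -/
noncomputable def deg (v : Ψ.V) : ℕ := Set.ncard {e : Ψ.E | Ψ.ter e = v}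

/-- `Ψ` is a finite graph. -/
def FiniteGraph : Prop := Finite Ψ.V ∧ Finite Ψ.E

/-- `Ψ` is a connected graph. -/
def Connected : Prop :=
  ∀ u v : Ψ.V,
    Relation.ReflTransGen (fun a b => ∃ e : Ψ.E, Ψ.ini e = a ∧ Ψ.ter e = b) u v

/-- Properties (P1)-(P3) of an irreducible `A`-graph. -/
def Irr : Prop :=
  (∀ e f : Ψ.E, Ψ.ini e = Ψ.ini f → Ψ.prim (Ψ.ini e) → Ψ.ter e ≠ Ψ.ter f →
      Ψ.typ (Ψ.ter e) ≠ Ψ.typ (Ψ.ter f)) ∧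
  (∀ e f : Ψ.E, e ≠ f → Ψ.ter e = Ψ.ter f → ¬ Ψ.prim (Ψ.ter e) → Ψ.lab e ≠ Ψ.lab f) ∧
  (∀ e f : Ψ.E, Ψ.ini e = Ψ.ini f → Ψ.ter e = Ψ.ter f → e = f) ∧
  (∀ v : Ψ.V, 0 < Ψ.deg v) ∧
  (∀ v w : Ψ.V, Ψ.deg v = 1 → Ψ.deg w = 1 → v = w) ∧
  (∀ v : Ψ.V, Ψ.deg v = 1 → Ψ.prim v)

/-- A path in `Ψ`: a list of consecutive edges. -/
def IsPath (p : List Ψ.E) : Prop := p.Chain' fun e f => Ψ.ter e = Ψ.ini f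

/-- A reduced path: a path with no subpath `e e⁻¹`. -/
def IsRedPath (p : List Ψ.E) : Prop :=
  p.Chain' fun e f => Ψ.ter e = Ψ.ini f ∧ f ≠ Ψ.bar e

/-- The path `p` is closed at `v` (a path of length `0` is closed at every vertex). -/
def ClosedAt (p : List Ψ.E) (v : Ψ.V) : Prop :=
  (∀ e ∈ p.head?, Ψ.ini e = v) ∧ (∀ e ∈ p.getLast?, Ψ.ter e = v)

/-- The label of a path: the product of the labels of its edges, in `∗_i G i`. -/
def pathLabel (p : List Ψ.E) : CoprodI G :=
  (p.map fun e => CoprodI.of (Ψ.lab e).2).prod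

/-- A cyclically reduced closed path: a nonempty reduced closed path whose cyclic
shift by one edge is also reduced. -/
def IsCycRed (p : List Ψ.E) : Prop :=
  p ≠ [] ∧ Ψ.IsRedPath p ∧
    ∀ e ∈ p.head?, ∀ f ∈ p.getLast?, Ψ.ter f = Ψ.ini e ∧ e ≠ Ψ.bar f

/-- The edges of the core of `Ψ`: the edges lying on a cyclically reduced closed path
(up to orientation). -/
def coreES : Set Ψ.E := {e | ∃ p, Ψ.IsCycRed p ∧ (e ∈ p ∨ Ψ.bar e ∈ p)}

/-- The vertices of the core of `Ψ`. -/
def coreVS : Set Ψ.V := {v | ∃ e ∈ Ψ.coreES, Ψ.ini e = v ∨ Ψ.ter e = v}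

/-- The core of `Ψ`: the minimal subgraph of `Ψ` containing every edge that lies on
a cyclically reduced closed path in `Ψ`. -/
def core : AGraph ι G where
  V := {v : Ψ.V // v ∈ Ψ.coreVS}
  E := {e : Ψ.E // e ∈ Ψ.coreES}
  prim v := Ψ.prim v.1
  bar e := ⟨Ψ.bar e.1, by
    obtain ⟨p, hp, he⟩ := e.2
    refine ⟨p, hp, ?_⟩
    rcases he with h | h
    · exact Or.inr (by rwa [Ψ.bar_bar])
    · exact Or.inl h⟩
  bar_bar e := Subtype.ext (Ψ.bar_bar e.1)
  bar_ne e h := Ψ.bar_ne e.1 (congrArg Subtype.val h)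
  ini e := ⟨Ψ.ini e.1, ⟨e.1, e.2, Or.inl rfl⟩⟩
  ter e := ⟨Ψ.ter e.1, ⟨e.1, e.2, Or.inr rfl⟩⟩
  ini_bar e := Subtype.ext (Ψ.ini_bar e.1)
  bipartite e := Ψ.bipartite e.1
  typ v := Ψ.typ v.1
  lab e := Ψ.lab e.1
  lab_bar e := Ψ.lab_bar e.1
  lab_typ e := Ψ.lab_typ e.1

end AGraph

variable {ι : Type} {G : ι → Type} [∀ i, Group (G i)]

/-- A subgroup of the free product `∗_i G i` is factor-free if it meets every conjugate
of every factor trivially. -/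
def FactorFreeI (H : Subgroup (CoprodI G)) : Prop :=
  ∀ (s : CoprodI G) (i : ι),
    H ⊓ conjS s (CoprodI.of : G i →* CoprodI G).range = ⊥

/-- `Ψ` with base vertex `o` is an irreducible graph of the subgroup `H`:
`Ψ` is a finite connected irreducible `A`-graph, `o` is primary (and is the vertex of
degree `1` if one exists), and a reduced word `W` lies in `H` iff it is the label of a
reduced path `p` closed at `o` with `|p| = 2|W|`. -/
def IsIrrGraphOf (Ψ : AGraph ι G) (o : Ψ.V) (H : Subgroup (CoprodI G)) : Prop :=
  Ψ.FiniteGraph ∧ Ψ.Connected ∧ Ψ.Irr ∧ Ψ.prim o ∧ (∀ v, Ψ.deg v = 1 → v = o) ∧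
    ∀ w : CoprodI.Word G,
      (w.prod ∈ H ↔ ∃ p : List Ψ.E, Ψ.IsRedPath p ∧ Ψ.ClosedAt p o ∧
        Ψ.pathLabel p = w.prod ∧ p.length = 2 * w.toList.length)

/-- `Ψ` is an irreducible core graph of `H`: the core of an irreducible graph of `H`. -/
def IsIrrCoreGraphOf (Ψ : AGraph ι G) (H : Subgroup (CoprodI G)) : Prop :=
  ∃ (Ψ₀ : AGraph ι G) (o : Ψ₀.V), IsIrrGraphOf Ψ₀ o H ∧ Ψ = Ψ₀.core

end Graphs

section Traversal

variable {ι : Type} {G : ι → Type} [∀ i, Group (G i)]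

/-- The element of the free product spelled by a (not necessarily reduced) list of syllables. -/
def syllableProd (l : List (Σ i, G i)) : CoprodI G :=
  (l.map fun a => CoprodI.of a.2).prod

@[simp]
theorem syllableProd_nil : syllableProd ([] : List (Σ i, G i)) = 1 := rfl

@[simp]
theorem syllableProd_cons (a : Σ i, G i) (l : List (Σ i, G i)) :
    syllableProd (a :: l) = CoprodI.of a.2 * syllableProd l := by
  simp [syllableProd]

@[simp]
theorem syllableProd_append (l l' : List (Σ i, G i)) :
    syllableProd (l ++ l') = syllableProd l * syllableProd l' := by
  simp [syllableProd]

/-- The list of syllables spelling the inverse element. -/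
def invSyllables (l : List (Σ i, G i)) : List (Σ i, G i) :=
  (l.map fun a => ⟨a.1, a.2⁻¹⟩).reverse

theorem invSyllables_cons (a : Σ i, G i) (l : List (Σ i, G i)) :
    invSyllables (a :: l) = invSyllables l ++ [⟨a.1, a.2⁻¹⟩] := by
  simp [invSyllables]

theorem syllableProd_invSyllables (l : List (Σ i, G i)) :
    syllableProd (invSyllables l) = (syllableProd l)⁻¹ := by
  induction l with
  | nil => simp [invSyllables]
  | cons a l ih => simp [invSyllables_cons, ih]

theorem word_prod_eq_syllableProd (w : CoprodI.Word G) : w.prod = syllableProd w.toList := rfl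

theorem word_prod_injective : Function.Injective (CoprodI.Word.prod : CoprodI.Word G → _) := by
  classical exact CoprodI.Word.equiv.symm.injective

theorem word_prod_surjective : Function.Surjective (CoprodI.Word.prod : CoprodI.Word G → _) := by
  classical exact CoprodI.Word.equiv.symm.surjective

variable {X : Type} [MulAction (CoprodI G) X]

/-- The pairs (point, factor) met when reading the syllables of a list one after the other,
starting at `c`; reading the syllable `a` moves a point `c` to `a⁻¹ • c`. -/
def traversed : X → List (Σ i, G i) → Set (X × ι)
  | _, [] => ∅
  | c, a :: l => {(c, a.1), ((CoprodI.of a.2)⁻¹ • c, a.1)} ∪ traversed ((CoprodI.of a.2)⁻¹ • c) l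

theorem mem_traversed_cons {c : X} {a : Σ i, G i} {l : List (Σ i, G i)} {q : X × ι} :
    q ∈ traversed c (a :: l) ↔
      q = (c, a.1) ∨ q = ((CoprodI.of a.2)⁻¹ • c, a.1) ∨
        q ∈ traversed ((CoprodI.of a.2)⁻¹ • c) l := by
  simp [traversed, or_assoc]

theorem traversed_finite (l : List (Σ i, G i)) (c : X) : (traversed c l).Finite := by
  induction l generalizing c with
  | nil => exact Set.finite_empty
  | cons a l ih => exact (Set.toFinite _).union (ih _)

theorem traversed_append (l l' : List (Σ i, G i)) (c : X) :
    traversed c (l ++ l') = traversed c l ∪ traversed ((syllableProd l)⁻¹ • c) l' := by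
  induction l generalizing c with
  | nil => simp [traversed]
  | cons a l ih => simp [traversed, ih, mul_smul, Set.union_assoc]

theorem traversed_invSyllables (l : List (Σ i, G i)) (c : X) :
    traversed ((syllableProd l)⁻¹ • c) (invSyllables l) = traversed c l := by
  induction l generalizing c with
  | nil => rfl
  | cons a l ih =>
    rw [invSyllables_cons, traversed_append, syllableProd_cons, mul_inv_rev, mul_smul, ih,
      syllableProd_invSyllables, inv_inv, smul_inv_smul]
    ext q
    simp only [Set.mem_union, mem_traversed_cons, map_inv, inv_inv, smul_inv_smul]
    simp only [traversed, Set.mem_empty_iff_false]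
    tauto

/-- Every list of syllables can be reduced, and the reduced word traverses nothing new. -/
theorem exists_word_traversed_subset (l : List (Σ i, G i)) :
    ∃ w : CoprodI.Word G, w.prod = syllableProd l ∧
      ∀ c : X, traversed c w.toList ⊆ traversed c l := by
  induction l with
  | nil => exact ⟨.empty, rfl, fun c => subset_rfl⟩
  | cons a l ih =>
    obtain ⟨w, hw, hsub⟩ := ih
    by_cases ha : a.2 = 1
    · refine ⟨w, by simp [hw, ha], fun c q hq => ?_⟩
      rw [mem_traversed_cons]
      simpa [ha] using Or.inr (hsub c hq)
    obtain ⟨L, hne, hch⟩ := w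
    rw [word_prod_eq_syllableProd] at hw
    dsimp only at hw hsub
    have key : ∀ c : X, traversed c (a :: L) ⊆ traversed c (a :: l) := fun c q hq => by
      rw [mem_traversed_cons] at hq ⊢
      exact hq.imp id (Or.imp id fun h => hsub _ h)
    rcases L with _ | ⟨b, L⟩
    · exact ⟨⟨[a], by simpa using ha, List.isChain_singleton _⟩,
        by simp [word_prod_eq_syllableProd, ← hw], key⟩
    have hneL : ∀ s ∈ L, s.2 ≠ 1 := fun s hs => hne s (List.mem_cons_of_mem _ hs)
    by_cases hab : a.1 = b.1
    · obtain ⟨i, x⟩ := a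
      obtain ⟨j, y⟩ := b
      obtain rfl : i = j := hab
      have hxy (c : X) : (CoprodI.of (x * y))⁻¹ • c =
          (CoprodI.of y)⁻¹ • (CoprodI.of x)⁻¹ • c := by
        rw [map_mul, mul_inv_rev, mul_smul]
      by_cases h1 : x * y = 1
      · refine ⟨⟨L, hneL, hch.tail⟩, ?_, fun c q hq => key c ?_⟩
        · rw [word_prod_eq_syllableProd, syllableProd_cons, ← hw, syllableProd_cons, ← mul_assoc,
            ← map_mul]
          simp [h1]
        · rw [mem_traversed_cons, mem_traversed_cons]
          dsimp only
          rw [← hxy, h1]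
          simp [show q ∈ traversed c L from hq]
      · refine ⟨⟨⟨i, x * y⟩ :: L, ?_, ?_⟩, ?_, fun c q hq => key c ?_⟩
        · simpa using ⟨h1, hneL⟩
        · rw [List.isChain_cons] at hch ⊢
          exact hch
        · rw [word_prod_eq_syllableProd, syllableProd_cons, syllableProd_cons, ← hw,
            syllableProd_cons, ← mul_assoc, ← map_mul]
        · dsimp only at hq
          rw [mem_traversed_cons] at hq
          dsimp only at hq
          rw [hxy] at hq
          rw [mem_traversed_cons, mem_traversed_cons]
          tauto
    · exact ⟨⟨a :: b :: L, by simpa using ⟨ha, by simpa using hne⟩, hch.cons_cons hab⟩,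
        by rw [word_prod_eq_syllableProd, syllableProd_cons a, hw, syllableProd_cons], key⟩

theorem exists_ne_one_smul_mem_traversed {l : List (Σ i, G i)} (hl : ∀ a ∈ l, a.2 ≠ 1) {c₀ c : X}
    {i : ι} (h : (c, i) ∈ traversed c₀ l) :
    ∃ x : G i, x ≠ 1 ∧ (CoprodI.of x • c, i) ∈ traversed c₀ l := by
  induction l generalizing c₀ with
  | nil => exact h.elim
  | cons a l ih =>
    simp only [mem_traversed_cons, Prod.mk.injEq] at h ⊢
    have ha : a.2 ≠ 1 := hl a List.mem_cons_self
    rcases h with ⟨rfl, rfl⟩ | ⟨rfl, rfl⟩ | h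
    · exact ⟨a.2⁻¹, inv_ne_one.2 ha, by simp⟩
    · exact ⟨a.2, ha, by simp⟩
    · obtain ⟨x, hx, hm⟩ := ih (fun b hb => hl b (List.mem_cons_of_mem _ hb)) h
      exact ⟨x, hx, Or.inr (Or.inr hm)⟩

/-- At an interior point of a reduced traversal at least two factors are met. -/
theorem exists_ne_mem_traversed {l : List (Σ i, G i)}
    (hl : l.IsChain fun a b => a.1 ≠ b.1) {c₀ c : X} {i : ι} (h : (c, i) ∈ traversed c₀ l)
    (h₀ : c ≠ c₀) (h₁ : c ≠ (syllableProd l)⁻¹ • c₀) :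
    ∃ j, j ≠ i ∧ (c, j) ∈ traversed c₀ l := by
  induction l generalizing c₀ with
  | nil => exact h.elim
  | cons a l ih =>
    simp only [mem_traversed_cons, Prod.mk.injEq] at h ⊢
    rw [syllableProd_cons, mul_inv_rev, mul_smul] at h₁
    by_cases hc : c = (CoprodI.of a.2)⁻¹ • c₀
    · subst hc
      by_cases hi : i = a.1
      · subst hi
        rcases l with _ | ⟨b, l⟩
        · simp at h₁
        · exact ⟨b.1, (List.isChain_cons_cons.1 hl).1.symm,
            Or.inr (Or.inr (mem_traversed_cons.2 (Or.inl rfl)))⟩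
      · exact ⟨a.1, Ne.symm hi, Or.inr (Or.inl ⟨rfl, rfl⟩)⟩
    · rcases h with h | h | h
      · exact absurd h.1 h₀
      · exact absurd h.1 hc
      · obtain ⟨j, hj, hm⟩ := ih hl.tail h hc h₁
        exact ⟨j, hj, Or.inr (Or.inr hm)⟩

/-- The pairs (point, factor) traversed by reduced words that fix `o`. -/
def loopTraversed (G : ι → Type) [∀ i, Group (G i)] {X : Type} [MulAction (CoprodI G) X] (o : X) :
    Set (X × ι) :=
  {q | ∃ w : CoprodI.Word G, w.prod • o = o ∧ q ∈ traversed o w.toList}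

theorem loopTraversed_finite {o : X} (hfg : (MulAction.stabilizer (CoprodI G) o).FG) :
    (loopTraversed G o).Finite := by
  obtain ⟨S, hS⟩ := hfg
  choose wd hwd using word_prod_surjective (G := G)
  have hT : (⋃ s ∈ S, traversed o (wd s).toList).Finite :=
    S.finite_toSet.biUnion fun s _ => traversed_finite _ _
  refine hT.subset ?_
  rintro q ⟨w, hw, hq⟩
  suffices H : ∀ g ∈ Subgroup.closure (S : Set (CoprodI G)),
      traversed o (wd g).toList ⊆ ⋃ s ∈ S, traversed o (wd s).toList by
    refine H w.prod (hS ▸ hw) ?_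
    rwa [word_prod_injective (hwd w.prod)]
  have hsub (l : List (Σ i, G i)) (g : CoprodI G) (hg : g = syllableProd l) :
      traversed o (wd g).toList ⊆ traversed o l := by
    obtain ⟨w', hw', hl⟩ := exists_word_traversed_subset (X := X) l
    rw [word_prod_injective ((hwd g).trans (hg.trans hw'.symm))]
    exact hl o
  have hfix (g : CoprodI G) (hg : g ∈ Subgroup.closure (S : Set (CoprodI G))) :
      (syllableProd (wd g).toList)⁻¹ • o = o := by
    rw [← word_prod_eq_syllableProd, hwd, inv_smul_eq_iff]
    rw [hS] at hg
    exact hg.symm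
  intro g hg
  induction hg using Subgroup.closure_induction with
  | mem g hg => exact Set.subset_biUnion_of_mem (u := fun s => traversed o (wd s).toList) hg
  | one => exact (hsub [] 1 rfl).trans (Set.empty_subset _)
  | mul x y hx hy ihx ihy =>
    refine (hsub ((wd x).toList ++ (wd y).toList) _ ?_).trans ?_
    · simp [← word_prod_eq_syllableProd, hwd]
    · rw [traversed_append, hfix x hx]
      exact Set.union_subset ihx ihy
  | inv x hx ihx =>
    refine (hsub (invSyllables (wd x).toList) _ ?_).trans ?_
    · rw [syllableProd_invSyllables, ← word_prod_eq_syllableProd, hwd]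
    · have h := traversed_invSyllables (wd x).toList o
      rw [hfix x hx] at h
      rwa [h]

end Traversal

section OrbitGraph

variable {ι : Type} {G : ι → Type} [∀ i, Group (G i)] {X : Type} [MulAction (CoprodI G) X]

theorem AGraph.pathLabel_cons (Ψ : AGraph ι G) (e : Ψ.E) (p : List Ψ.E) :
    Ψ.pathLabel (e :: p) = CoprodI.of (Ψ.lab e).2 * Ψ.pathLabel p := by
  simp [AGraph.pathLabel]

variable (X) in
/-- One can choose representatives of the orbits of all factors simultaneously. -/
theorem exists_orbit_rep :
    ∃ t : ∀ i, X → G i, ∀ (i : ι) (c : X) (x : G i),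
      CoprodI.of (t i (CoprodI.of x • c)) • CoprodI.of x • c = CoprodI.of (t i c) • c := by
  have hne (i : ι) (c : X) : {d : X | ∃ x : G i, CoprodI.of x • c = d}.Nonempty := ⟨_, 1, rfl⟩
  choose t ht using fun (i : ι) (c : X) => (hne i c).some_mem
  refine ⟨t, fun i c x => ?_⟩
  rw [ht, ht]
  congr 1
  ext d
  constructor
  · rintro ⟨y, rfl⟩
    exact ⟨y * x, by rw [map_mul, mul_smul]⟩
  · rintro ⟨y, rfl⟩
    exact ⟨y * x⁻¹, by rw [map_mul, mul_smul, map_inv, inv_smul_smul]⟩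

/-- The graph with primary vertices the points of `X` and secondary vertices the orbits of the
factors (each given by its representative `of (t i c) • c`), with an edge joining a point `c` to
its `i`-orbit for every `(c, i) ∈ B`. -/
def orbitGraph (t : ∀ i, X → G i) (B : Set (X × ι)) (i₀ : ι) : AGraph ι G where
  V := {v : X ⊕ ι × X //
    ∃ q ∈ B, v = .inl q.1 ∨ v = .inr (q.2, CoprodI.of (t q.2 q.1) • q.1)}
  E := B × Bool
  prim v := v.1.isLeft
  bar e := (e.1, !e.2)
  bar_bar e := by simp
  bar_ne e h := by simpa using congrArg Prod.snd h
  ini e := ⟨if e.2 then .inl e.1.1.1 else .inr (e.1.1.2, CoprodI.of (t e.1.1.2 e.1.1.1) • e.1.1.1),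
    e.1, e.1.2, by split <;> simp⟩
  ter e := ⟨if e.2 then .inr (e.1.1.2, CoprodI.of (t e.1.1.2 e.1.1.1) • e.1.1.1) else .inl e.1.1.1,
    e.1, e.1.2, by split <;> simp⟩
  ini_bar e := by rcases e with ⟨q, _ | _⟩ <;> simp
  bipartite e := by rcases e with ⟨q, _ | _⟩ <;> simp
  typ v := v.1.elim (fun _ => i₀) Prod.fst
  lab e := ⟨e.1.1.2, if e.2 then (t e.1.1.2 e.1.1.1)⁻¹ else t e.1.1.2 e.1.1.1⟩
  lab_bar e := by rcases e with ⟨q, _ | _⟩ <;> simp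
  lab_typ e h := by rcases e with ⟨q, _ | _⟩ <;> simp_all

variable {t : ∀ i, X → G i} {B : Set (X × ι)} {i₀ : ι}

/-- The point of `X` attached to a vertex: the point itself, or the representative of the orbit. -/
def orbitGraphPoint (v : (orbitGraph t B i₀).V) : X := v.1.elim id Prod.snd

theorem orbitGraph_finite (hB : B.Finite) : (orbitGraph t B i₀).FiniteGraph := by
  have : Finite B := hB
  have hE : Finite (orbitGraph t B i₀).E := inferInstanceAs (Finite (B × Bool))
  refine ⟨Finite.of_surjective (orbitGraph t B i₀).ini ?_, hE⟩
  rintro ⟨v, q, hq, rfl | rfl⟩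
  · exact ⟨(⟨q, hq⟩, true), rfl⟩
  · exact ⟨(⟨q, hq⟩, false), rfl⟩

theorem orbitGraph_point_ter (e : (orbitGraph t B i₀).E) :
    orbitGraphPoint ((orbitGraph t B i₀).ter e) =
      (CoprodI.of ((orbitGraph t B i₀).lab e).2)⁻¹ •
        orbitGraphPoint ((orbitGraph t B i₀).ini e) := by
  rcases e with ⟨q, _ | _⟩
  · exact (inv_smul_smul _ _).symm
  · change CoprodI.of (t q.1.2 q.1.1) • q.1.1 = (CoprodI.of (t q.1.2 q.1.1)⁻¹)⁻¹ • q.1.1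
    rw [map_inv, inv_inv]

/-- Closed paths are labelled by elements fixing the base point. -/
theorem orbitGraph_pathLabel_smul {p : List (orbitGraph t B i₀).E}
    (hp : p.IsChain fun e f => (orbitGraph t B i₀).ter e = (orbitGraph t B i₀).ini f)
    {u v : (orbitGraph t B i₀).V} (hu : ∀ e ∈ p.head?, (orbitGraph t B i₀).ini e = u)
    (hv : ∀ e ∈ p.getLast?, (orbitGraph t B i₀).ter e = v) (hne : p ≠ []) :
    (orbitGraph t B i₀).pathLabel p • orbitGraphPoint v = orbitGraphPoint u := by
  induction p generalizing u with
  | nil => exact absurd rfl hne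
  | cons e p ih =>
    obtain rfl := hu e rfl
    rw [AGraph.pathLabel_cons, mul_smul, ← eq_inv_smul_iff, ← orbitGraph_point_ter]
    rcases p with _ | ⟨f, p⟩
    · rw [hv e rfl]
      simp [AGraph.pathLabel]
    · have hef := (List.isChain_cons_cons.1 hp).1
      exact ih hp.tail (fun e' he' => by simp_all) (fun e' he' => hv e' (by simpa using he'))
        (List.cons_ne_nil _ _)

variable (hfree : ∀ (i : ι) (x : G i) (c : X), CoprodI.of x • c = c → x = 1)
  (ht : ∀ (i : ι) (c : X) (x : G i),
    CoprodI.of (t i (CoprodI.of x • c)) • CoprodI.of x • c = CoprodI.of (t i c) • c)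

include hfree ht in
theorem orbit_rep_inv_mul (i : ι) (x : G i) (c : X) :
    (t i c)⁻¹ * t i ((CoprodI.of x)⁻¹ • c) = x := by
  have h := ht i c x⁻¹
  rw [map_inv] at h
  have : (t i c)⁻¹ * t i ((CoprodI.of x)⁻¹ • c) * x⁻¹ = 1 := by
    apply hfree i _ c
    simp only [map_mul, map_inv, mul_smul, h, inv_smul_smul]
  exact mul_inv_eq_one.1 this

include hfree ht in
/-- Every reduced list of syllables traversing only pairs in `B` is read along a reduced path. -/
theorem orbitGraph_exists_path {l : List (Σ i, G i)} (hne : ∀ a ∈ l, a.2 ≠ 1)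
    (hch : l.IsChain fun a b => a.1 ≠ b.1) {c : X} (hB : traversed c l ⊆ B) :
    ∃ p : List (orbitGraph t B i₀).E, (orbitGraph t B i₀).IsRedPath p ∧
      (orbitGraph t B i₀).pathLabel p = syllableProd l ∧ p.length = 2 * l.length ∧
      (∀ e ∈ p.head?, ∃ a ∈ l.head?, e.1.1 = (c, a.1) ∧ e.2 = true) ∧
      (∀ e ∈ p.getLast?, e.1.1.1 = (syllableProd l)⁻¹ • c ∧ e.2 = false) := by
  induction l generalizing c with
  | nil => exact ⟨[], List.isChain_nil, rfl, rfl, by simp, by simp⟩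
  | cons a l ih =>
    obtain ⟨p, hred, hlab, hlen, hhead, hlast⟩ :=
      ih (fun b hb => hne b (List.mem_cons_of_mem _ hb)) hch.tail
        (fun q hq => hB (mem_traversed_cons.2 (Or.inr (Or.inr hq))))
    have h₁ : (c, a.1) ∈ B := hB (mem_traversed_cons.2 (Or.inl rfl))
    have h₂ : ((CoprodI.of a.2)⁻¹ • c, a.1) ∈ B := hB (mem_traversed_cons.2 (Or.inr (Or.inl rfl)))
    have hmove : (CoprodI.of a.2)⁻¹ • c ≠ c := fun h => by
      rw [← map_inv] at h
      exact hne a List.mem_cons_self (inv_eq_one.1 (hfree _ _ _ h))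
    have hrep := ht a.1 c a.2⁻¹
    rw [map_inv] at hrep
    obtain ⟨e₁, he₁⟩ : ∃ e : (orbitGraph t B i₀).E, e = (⟨_, h₁⟩, true) := ⟨_, rfl⟩
    obtain ⟨e₂, he₂⟩ : ∃ e : (orbitGraph t B i₀).E, e = (⟨_, h₂⟩, false) := ⟨_, rfl⟩
    refine ⟨e₁ :: e₂ :: p, ?_, ?_, ?_, ?_, ?_⟩
    · refine List.isChain_cons_cons.2 ⟨⟨?_, ?_⟩, List.isChain_cons.2 ⟨?_, hred⟩⟩
      · subst he₁ he₂
        exact Subtype.ext (by simp [orbitGraph, hrep])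
      · subst he₁ he₂
        exact fun h => hmove (congrArg (fun e : B × Bool => e.1.1.1) h)
      · intro e he
        obtain ⟨b, hb, heq, htrue⟩ := hhead e he
        subst he₂
        refine ⟨Subtype.ext (by simp [orbitGraph, heq, htrue]), fun h => ?_⟩
        have h' : e.1.1.2 = a.1 := congrArg (fun e : B × Bool => e.1.1.2) h
        rw [heq] at h'
        exact (List.isChain_cons.1 hch).1 b hb h'.symm
    · rw [AGraph.pathLabel_cons, AGraph.pathLabel_cons, ← mul_assoc, hlab, syllableProd_cons]
      subst he₁ he₂
      congr 1
      change CoprodI.of (t a.1 c)⁻¹ * CoprodI.of (t a.1 ((CoprodI.of a.2)⁻¹ • c)) = _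
      rw [← map_mul, orbit_rep_inv_mul hfree ht]
    · simp only [List.length_cons, hlen]
      ring
    · intro e he
      obtain rfl : e₁ = e := by simpa using he
      exact ⟨a, rfl, by simp [he₁]⟩
    · rcases p with _ | ⟨f, p⟩
      · obtain rfl : l = [] := List.length_eq_zero_iff.1 (by simpa using hlen.symm)
        intro e he
        obtain rfl : e₂ = e := by simpa using he
        simp [he₂]
      · intro e he
        rw [syllableProd_cons, mul_inv_rev, mul_smul]
        exact hlast e (by simpa using he)

theorem AGraph.two_le_deg {Ψ : AGraph ι G} [Finite Ψ.E] {v : Ψ.V} {e f : Ψ.E} (he : Ψ.ter e = v)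
    (hf : Ψ.ter f = v) (hef : e ≠ f) : 2 ≤ Ψ.deg v :=
  (Set.one_lt_ncard (Set.toFinite _)).2 ⟨e, he, f, hf, hef⟩

theorem AGraph.reflTransGen_symm (Ψ : AGraph ι G) {u v : Ψ.V}
    (h : Relation.ReflTransGen (fun a b => ∃ e : Ψ.E, Ψ.ini e = a ∧ Ψ.ter e = b) u v) :
    Relation.ReflTransGen (fun a b => ∃ e : Ψ.E, Ψ.ini e = a ∧ Ψ.ter e = b) v u := by
  induction h with
  | refl => exact .refl
  | tail _ he ih =>
    obtain ⟨e, rfl, rfl⟩ := he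
    exact .head ⟨Ψ.bar e, Ψ.ini_bar e, by rw [← Ψ.ini_bar, Ψ.bar_bar]⟩ ih

/-- The primary vertex of a point. -/
def orbitGraphPrimary {c : X} {i : ι} (h : (c, i) ∈ B) : (orbitGraph t B i₀).V :=
  ⟨.inl c, _, h, Or.inl rfl⟩

include ht in
theorem orbitGraph_reachable {l : List (Σ i, G i)} {c₀ c : X} {i₁ i : ι} (hB : traversed c₀ l ⊆ B)
    (h₀ : (c₀, i₁) ∈ B) (h : (c, i) ∈ B) (hc : (c, i) ∈ traversed c₀ l) :
    Relation.ReflTransGen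
      (fun a b => ∃ e, (orbitGraph t B i₀).ini e = a ∧ (orbitGraph t B i₀).ter e = b)
      (orbitGraphPrimary h₀) (orbitGraphPrimary h) := by
  induction l generalizing c₀ i₁ with
  | nil => exact hc.elim
  | cons a l ih =>
    have h₁ : (c₀, a.1) ∈ B := hB (mem_traversed_cons.2 (Or.inl rfl))
    have h₂ : ((CoprodI.of a.2)⁻¹ • c₀, a.1) ∈ B := hB (mem_traversed_cons.2 (Or.inr (Or.inl rfl)))
    have hrep := ht a.1 c₀ a.2⁻¹
    rw [map_inv] at hrep
    have hstep : Relation.ReflTransGen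
        (fun a b => ∃ e, (orbitGraph t B i₀).ini e = a ∧ (orbitGraph t B i₀).ter e = b)
        (orbitGraphPrimary h₀) (orbitGraphPrimary h₂) := by
      refine .trans (.single ⟨(⟨_, h₁⟩, true), rfl, rfl⟩) (.single ⟨(⟨_, h₂⟩, false), ?_, rfl⟩)
      exact Subtype.ext (by simp [orbitGraph, hrep])
    rw [mem_traversed_cons] at hc
    simp only [Prod.mk.injEq] at hc
    rcases hc with ⟨rfl, -⟩ | ⟨rfl, -⟩ | hc
    · exact .refl
    · exact hstep
    · exact hstep.trans (ih (fun q hq => hB (mem_traversed_cons.2 (Or.inr (Or.inr hq)))) h₂ hc)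

theorem traversed_subset_loopTraversed {o : X} {w : CoprodI.Word G} (hw : w.prod • o = o) :
    traversed o w.toList ⊆ loopTraversed G o := fun _ hq => ⟨w, hw, hq⟩

include ht in
theorem orbitGraph_connected {o : X} :
    (orbitGraph t (loopTraversed G o) i₀).Connected := by
  have hne {q : X × ι} (hq : q ∈ loopTraversed G o) : ∃ i, (o, i) ∈ loopTraversed G o := by
    obtain ⟨⟨_ | ⟨a, l⟩, h₁, h₂⟩, hw, hq⟩ := hq
    · exact hq.elim
    · exact ⟨a.1, _, hw, mem_traversed_cons.2 (Or.inl rfl)⟩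
  have hprim {q : X × ι} (hq : q ∈ loopTraversed G o) {i : ι} (hi : (o, i) ∈ loopTraversed G o) :
      Relation.ReflTransGen (fun a b => ∃ e, (orbitGraph t (loopTraversed G o) i₀).ini e = a ∧
        (orbitGraph t (loopTraversed G o) i₀).ter e = b)
        (orbitGraphPrimary hi) (orbitGraphPrimary hq) := by
    obtain ⟨w, hw, hq'⟩ := hq
    exact orbitGraph_reachable ht (traversed_subset_loopTraversed hw) hi _ hq'
  suffices H : ∀ (v : (orbitGraph t (loopTraversed G o) i₀).V) {i : ι}
      (hi : (o, i) ∈ loopTraversed G o),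
      Relation.ReflTransGen (fun a b => ∃ e, (orbitGraph t (loopTraversed G o) i₀).ini e = a ∧
        (orbitGraph t (loopTraversed G o) i₀).ter e = b) (orbitGraphPrimary hi) v by
    intro u v
    obtain ⟨q, hq, -⟩ := u.2
    obtain ⟨i, hi⟩ := hne hq
    exact (AGraph.reflTransGen_symm _ (H u hi)).trans (H v hi)
  rintro ⟨v, q, hq, rfl | rfl⟩ i hi
  · exact hprim hq hi
  · exact (hprim hq hi).tail ⟨(⟨q, hq⟩, true), rfl, rfl⟩

include hfree ht in
theorem orbitGraph_two_le_deg {o : X} (hfin : (loopTraversed G o).Finite)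
    (v : (orbitGraph t (loopTraversed G o) i₀).V) (hv : v.1 ≠ .inl o) :
    2 ≤ (orbitGraph t (loopTraversed G o) i₀).deg v := by
  have : Finite (orbitGraph t (loopTraversed G o) i₀).E := (orbitGraph_finite hfin).2
  obtain ⟨v, ⟨c, i⟩, hq, rfl | rfl⟩ := v
  · obtain ⟨w, hw, hc⟩ := id hq
    have hco : c ≠ o := fun h => hv (by simp [h])
    obtain ⟨j, hj, hm⟩ := exists_ne_mem_traversed w.chain_ne hc hco (by
      rwa [← word_prod_eq_syllableProd, inv_smul_eq_iff.2 hw.symm])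
    refine AGraph.two_le_deg (e := (⟨_, hq⟩, false)) (f := (⟨(c, j), w, hw, hm⟩, false)) rfl rfl
      fun h => hj ?_
    exact (congrArg (fun e : loopTraversed G o × Bool => e.1.1.2) h).symm
  · obtain ⟨w, hw, hc⟩ := id hq
    obtain ⟨x, hx, hm⟩ := exists_ne_one_smul_mem_traversed w.ne_one hc
    refine AGraph.two_le_deg (e := (⟨_, hq⟩, true)) (f := (⟨_, w, hw, hm⟩, true)) rfl ?_
      fun h => hx (hfree i x c ?_)
    · exact Subtype.ext (by simp [orbitGraph, ht])
    · exact (congrArg (fun e : loopTraversed G o × Bool => e.1.1.1) h).symm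

theorem AGraph.deg_pos {Ψ : AGraph ι G} [Finite Ψ.E] (e : Ψ.E) : 0 < Ψ.deg (Ψ.ter e) :=
  (Set.ncard_pos (Set.toFinite _)).2 ⟨e, rfl⟩

include hfree ht in
theorem orbitGraph_irr {o : X} (hfin : (loopTraversed G o).Finite) :
    (orbitGraph t (loopTraversed G o) i₀).Irr := by
  have : Finite (orbitGraph t (loopTraversed G o) i₀).E := (orbitGraph_finite hfin).2
  have hdeg (v : (orbitGraph t (loopTraversed G o) i₀).V)
      (h : (orbitGraph t (loopTraversed G o) i₀).deg v = 1) : v.1 = .inl o := by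
    by_contra hv
    have := orbitGraph_two_le_deg hfree ht hfin v hv
    omega
  refine ⟨?_, ?_, ?_, ?_, fun v w hv hw => Subtype.ext ((hdeg v hv).trans (hdeg w hw).symm),
    fun v hv => by simp [orbitGraph, hdeg v hv]⟩
  · rintro ⟨⟨⟨c, i⟩, hc⟩, _ | _⟩ ⟨⟨⟨d, j⟩, hd⟩, _ | _⟩ <;> simp +contextual [orbitGraph]
    rintro rfl h rfl
    exact h rfl rfl
  · rintro ⟨⟨⟨c, i⟩, hc⟩, _ | _⟩ ⟨⟨⟨d, j⟩, hd⟩, _ | _⟩ <;> simp +contextual [orbitGraph]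
    rintro h rfl h' h''
    rw [h''] at h'
    exact h (smul_left_cancel _ h') rfl
  · rintro ⟨⟨⟨c, i⟩, hc⟩, _ | _⟩ ⟨⟨⟨d, j⟩, hd⟩, _ | _⟩ <;> simp +contextual [orbitGraph]
  · rintro ⟨v, q, hq, rfl | rfl⟩
    · exact AGraph.deg_pos (Ψ := orbitGraph t (loopTraversed G o) i₀) (⟨q, hq⟩, false)
    · exact AGraph.deg_pos (Ψ := orbitGraph t (loopTraversed G o) i₀) (⟨q, hq⟩, true)

include hfree ht in
/-- If the factors act freely and the stabilizer of `o` is finitely generated and nontrivial, the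
part of the orbit graph traversed by loops at `o` is an irreducible graph of the stabilizer. -/
theorem isIrrGraphOf_stabilizer {o : X} (hfin : (loopTraversed G o).Finite) {i : ι}
    (ho : (o, i) ∈ loopTraversed G o) :
    IsIrrGraphOf (orbitGraph t (loopTraversed G o) i₀) (orbitGraphPrimary ho)
      (MulAction.stabilizer (CoprodI G) o) := by
  refine ⟨orbitGraph_finite hfin, orbitGraph_connected ht, orbitGraph_irr hfree ht hfin, rfl,
    fun v hv => ?_, fun w => ⟨fun hw => ?_, ?_⟩⟩
  · by_contra h
    have := orbitGraph_two_le_deg hfree ht hfin v fun h' => h (Subtype.ext h')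
    omega
  · obtain ⟨p, hred, hlab, hlen, hhead, hlast⟩ := orbitGraph_exists_path (i₀ := i₀) hfree ht
      w.ne_one w.chain_ne (traversed_subset_loopTraversed hw)
    refine ⟨p, hred, ⟨fun e he => ?_, fun e he => ?_⟩, hlab, hlen⟩
    · obtain ⟨a, -, h₁, h₂⟩ := hhead e he
      exact Subtype.ext (by simp [orbitGraph, orbitGraphPrimary, h₁, h₂])
    · obtain ⟨h₁, h₂⟩ := hlast e he
      rw [← word_prod_eq_syllableProd, inv_smul_eq_iff.2 hw.symm] at h₁
      exact Subtype.ext (by simp [orbitGraph, orbitGraphPrimary, h₁, h₂])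
  · rintro ⟨p, hred, ⟨hhead, hlast⟩, hlab, -⟩
    rw [← hlab]
    by_cases hp : p = []
    · subst hp
      exact one_mem _
    · exact orbitGraph_pathLabel_smul (List.IsChain.imp (fun _ _ h => h.1) hred) hhead hlast hp

end OrbitGraph

theorem FactorFreeI.eq_one_of_smul_eq {ι : Type} {G : ι → Type} [∀ i, Group (G i)]
    {H : Subgroup (CoprodI G)} (hH : FactorFreeI H) (i : ι) (x : G i) (c : CoprodI G ⧸ H)
    (h : CoprodI.of x • c = c) : x = 1 := by
  induction c using QuotientGroup.induction_on with
  | H g =>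
    have hmem : g⁻¹ * CoprodI.of x * g ∈ H := by
      have h' : ((CoprodI.of x * g : CoprodI G) : CoprodI G ⧸ H) = g := h
      rw [mul_assoc]
      exact QuotientGroup.eq.1 h'.symm
    have hbot : g⁻¹ * CoprodI.of x * g ∈
        H ⊓ conjS g⁻¹ (CoprodI.of : G i →* CoprodI G).range :=
      ⟨hmem, CoprodI.of x, ⟨x, rfl⟩, by simp⟩
    rw [hH g⁻¹ i, Subgroup.mem_bot] at hbot
    have h1 : CoprodI.of x = (1 : CoprodI G) := by
      simpa [mul_assoc] using congrArg (fun y => g * y * g⁻¹) hbot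
    classical exact CoprodI.of_injective i (h1.trans (map_one _).symm)

/-- Lemma 1: every nontrivial finitely generated factor-free subgroup `H`
of the free product of nontrivial groups admits an irreducible graph: a finite connected
irreducible `A`-graph `Ψ` with a primary base vertex `o` (which is the degree-1 vertex
if one exists) such that a reduced word `W` lies in `H` iff `W` is the label of a
reduced path in `Ψ` closed at `o` of length `2|W|`. -/
theorem statement7 {ι : Type} {G : ι → Type} [∀ i, Group (G i)]
    [∀ i, Nontrivial (G i)]
    (H : Subgroup (CoprodI G)) (hfg : H.FG) (hff : FactorFreeI H) (hne : H ≠ ⊥) :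
    ∃ (Ψ : AGraph ι G) (o : Ψ.V), IsIrrGraphOf Ψ o H := by
  have hstab : MulAction.stabilizer (CoprodI G) ((1 : CoprodI G) : CoprodI G ⧸ H) = H :=
    MulAction.stabilizer_quotient H
  have hfin := loopTraversed_finite (hstab.symm ▸ hfg)
  obtain ⟨h, hh, h1⟩ := H.bot_or_exists_ne_one.resolve_left hne
  obtain ⟨⟨_ | ⟨a, l⟩, hl, hch⟩, rfl⟩ := word_prod_surjective h
  · exact absurd rfl h1
  have ho : (((1 : CoprodI G) : CoprodI G ⧸ H), a.1) ∈ loopTraversed G _ :=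
    ⟨_, hstab.ge hh, mem_traversed_cons.2 (Or.inl rfl)⟩
  obtain ⟨t, ht⟩ := exists_orbit_rep (G := G) (CoprodI G ⧸ H)
  have key := isIrrGraphOf_stabilizer (i₀ := a.1) hff.eq_one_of_smul_eq ht hfin ho
  rw [hstab] at key
  exact ⟨_, _, key⟩
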